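/- Let M be a measurable space, f : M → M a measurable map, μ an ergodic f-invariant probability measure on M, and r : M → ℝ a measurable roof function with r(x) ≥ r₀ for all x, where r₀ > 0 is a constant, and with ∫ r dμ < ∞. Let ψ : M_r → ℝ be bounded and measurable, and set φ(x) = ∫_0^{r(x)} ψ(x,t) dt. Then for μ-almost every x ∈ M and every s with 0 ≤ s < r(x), the time averages converge: (1/T) ∫_0^T ψ(X^t(x,s)) dt → (∫ φ dμ)/(∫ r dμ) as T → ∞. -/

import Mathlib

open MeasureTheory Filter intervalIntegral
open scoped Topology

/-- Birkhoff sum `S_n g(x) = ∑_{j=0}^{n-1} g(f^j x)`. -/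
noncomputable def birkhoff {M : Type*} (f : M → M) (g : M → ℝ) (n : ℕ) (x : M) : ℝ :=
  ∑ j ∈ Finset.range n, g (f^[j] x)

/-- The lap number `n(x,s,T)`: the largest `n` with `S_n r(x) ≤ s + T`. -/
noncomputable def lap {M : Type*} (f : M → M) (r : M → ℝ) (x : M) (s T : ℝ) : ℕ :=
  sSup {n : ℕ | birkhoff f r n x ≤ s + T}

/-- The time-`T` map of the suspension semiflow:
`X^T(x,s) = (f^n x, s + T - S_n r(x))` with `n = n(x,s,T)`. -/
noncomputable def suspFlow {M : Type*} (f : M → M) (r : M → ℝ) (T : ℝ) (z : M × ℝ) :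
    M × ℝ :=
  (f^[lap f r z.1 z.2 T] z.1, z.2 + T - birkhoff f r (lap f r z.1 z.2 T) z.1)

section aux

variable {M : Type*}

lemma birkhoff_zero' (f : M → M) (g : M → ℝ) (x : M) : birkhoff f g 0 x = 0 := by
  simp [birkhoff]

lemma birkhoff_succ_left (f : M → M) (g : M → ℝ) (n : ℕ) (x : M) :
    birkhoff f g (n + 1) x = g x + birkhoff f g n (f x) := by
  simp only [birkhoff, Finset.sum_range_succ', Function.iterate_succ_apply]
  simp [add_comm]

lemma birkhoff_succ_right (f : M → M) (g : M → ℝ) (n : ℕ) (x : M) :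
    birkhoff f g (n + 1) x = birkhoff f g n x + g (f^[n] x) := by
  simp only [birkhoff, Finset.sum_range_succ]

/-- running maximum of Birkhoff sums -/
noncomputable def bmax (f : M → M) (g : M → ℝ) : ℕ → M → ℝ
  | 0, _ => 0
  | n + 1, x => max 0 (g x + bmax f g n (f x))

lemma bmax_nonneg (f : M → M) (g : M → ℝ) (n : ℕ) (x : M) : 0 ≤ bmax f g n x := by
  cases n with
  | zero => simp [bmax]
  | succ n => simp [bmax]

lemma bmax_mono (f : M → M) (g : M → ℝ) (n : ℕ) :
    ∀ x : M, bmax f g n x ≤ bmax f g (n + 1) x := by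
  induction n with
  | zero => intro x; exact bmax_nonneg f g 1 x
  | succ n ih =>
    intro x
    have := ih (f x)
    rw [bmax, bmax]
    exact max_le_max le_rfl (by linarith)

lemma birkhoff_le_bmax (f : M → M) (g : M → ℝ) (n : ℕ) :
    ∀ x : M, birkhoff f g n x ≤ bmax f g n x := by
  induction n with
  | zero => intro x; simp [birkhoff_zero', bmax]
  | succ n ih =>
    intro x
    rw [birkhoff_succ_left, bmax]
    exact le_max_of_le_right (by linarith [ih (f x)])

variable [MeasurableSpace M]

lemma bmax_measurable {f : M → M} (hf : Measurable f) {g : M → ℝ} (hg : Measurable g) (n : ℕ) :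
    Measurable (bmax f g n) := by
  induction n with
  | zero => exact measurable_const
  | succ n ih =>
    exact measurable_const.max (hg.add (ih.comp hf))

lemma bmax_integrable {f : M → M} {μ : Measure M} (hf : MeasurePreserving f μ μ)
    {g : M → ℝ} (hg : Integrable g μ) (n : ℕ) :
    Integrable (bmax f g n) μ := by
  induction n with
  | zero => exact integrable_zero _ _ _
  | succ n ih =>
    have h : Integrable (fun x => g x + bmax f g n (f x)) μ :=
      hg.add (hf.integrable_comp_of_integrable ih)
    have := (integrable_zero M ℝ μ).sup h
    exact this

lemma ae_bdd_of_neg {f : M → M} {μ : Measure M} [IsProbabilityMeasure μ] (herg : Ergodic f μ)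
    {g : M → ℝ} (hgm : Measurable g) (hg : Integrable g μ) (hneg : ∫ x, g x ∂μ < 0) :
    ∀ᵐ x ∂μ, ∃ K : ℝ, ∀ n, birkhoff f g n x ≤ K := by
  have hmp := herg.toMeasurePreserving
  have hf := hmp.measurable
  set B : Set M := {x | BddAbove (Set.range fun n => bmax f g n x)} with hB
  have hBm : MeasurableSet B := measurableSet_bddAbove_range (fun n => bmax_measurable hf hgm n)
  have hinv : f ⁻¹' B = B := by
    ext x
    simp only [hB, Set.mem_preimage, Set.mem_ofPred_eq, bddAbove_def, Set.forall_mem_range]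
    constructor
    · rintro ⟨K, hK⟩
      refine ⟨max 0 (g x + K), fun n => ?_⟩
      cases n with
      | zero => simp [bmax]
      | succ n => rw [bmax]; exact max_le_max le_rfl (by linarith [hK n])
    · rintro ⟨K, hK⟩
      refine ⟨K - g x, fun n => ?_⟩
      have := hK (n + 1)
      rw [bmax] at this
      linarith [le_max_right 0 (g x + bmax f g n (f x))]
  have key : ∀ᵐ x ∂μ, x ∈ B := by
    rcases herg.ae_mem_or_ae_notMem hBm hinv with h | h
    · exact h
    exfalso
    have hlim : Tendsto (fun n => ∫ x, (bmax f g (n + 1) x - bmax f g n (f x)) ∂μ) atTop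
        (𝓝 (∫ x, g x ∂μ)) := by
      apply tendsto_integral_of_dominated_convergence (fun x => |g x|)
      · intro n
        exact ((bmax_measurable hf hgm (n + 1)).sub
          ((bmax_measurable hf hgm n).comp hf)).aestronglyMeasurable
      · exact hg.abs
      · intro n
        refine Eventually.of_forall fun x => ?_
        have h0 := bmax_nonneg f g n (f x)
        rw [Real.norm_eq_abs, bmax]
        rcases max_cases 0 (g x + bmax f g n (f x)) with ⟨h1, h2⟩ | ⟨h1, h2⟩
        · rw [h1, abs_le]
          constructor
          · linarith [neg_abs_le (g x), neg_le_abs (g x)]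
          · linarith [abs_nonneg (g x)]
        · rw [h1]; simp
      · filter_upwards [h] with x hx
        have hx' : f x ∉ B := by
          intro h'; apply hx; rw [← hinv]; exact h'
        have : ∃ n, -g x < bmax f g n (f x) := by
          by_contra hcon
          push Not at hcon
          exact hx' ⟨-g x, by rintro _ ⟨n, rfl⟩; exact hcon n⟩
        obtain ⟨n, hn⟩ := this
        apply tendsto_const_nhds.congr'
        filter_upwards [eventually_ge_atTop n] with m hm
        have hmono : bmax f g n (f x) ≤ bmax f g m (f x) :=
          monotone_nat_of_le_succ (f := fun n => bmax f g n (f x))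
            (fun k => bmax_mono f g k (f x)) hm
        rw [bmax, max_eq_right (by linarith)]
        ring
    have hge : ∀ n, 0 ≤ ∫ x, (bmax f g (n + 1) x - bmax f g n (f x)) ∂μ := by
      intro n
      have hi := bmax_integrable hmp hg n
      have hi1 := bmax_integrable hmp hg (n + 1)
      have hic : Integrable (fun x => bmax f g n (f x)) μ := hmp.integrable_comp_of_integrable hi
      rw [MeasureTheory.integral_sub hi1 hic]
      have e : ∫ x, bmax f g n (f x) ∂μ = ∫ x, bmax f g n x ∂μ := by
        have := integral_map (μ := μ) hf.aemeasurable (f := bmax f g n)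
          (bmax_measurable hf hgm n).aestronglyMeasurable
        rw [hmp.map_eq] at this
        exact this.symm
      rw [e]
      have := integral_mono hi hi1 (bmax_mono f g n)
      linarith
    have := ge_of_tendsto' hlim hge
    linarith
  filter_upwards [key] with x ⟨K, hK⟩
  exact ⟨K, fun n => (birkhoff_le_bmax f g n x).trans (hK ⟨n, rfl⟩)⟩

lemma birkhoff_affine (f : M → M) (g : M → ℝ) (a c : ℝ) (n : ℕ) (x : M) :
    birkhoff f (fun y => a * g y - c) n x = a * birkhoff f g n x - n * c := by
  simp [birkhoff, Finset.sum_sub_distrib, Finset.mul_sum]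

lemma ae_birkhoff_upper {f : M → M} {μ : Measure M} [IsProbabilityMeasure μ] (herg : Ergodic f μ)
    {g : M → ℝ} (hgm : Measurable g) (hg : Integrable g μ) (a : ℝ) :
    ∀ᵐ x ∂μ, ∀ ε > 0, ∀ᶠ n : ℕ in atTop,
      a * (birkhoff f g n x / n) < a * (∫ x, g x ∂μ) + ε := by
  have h : ∀ k : ℕ, ∀ᵐ x ∂μ, ∃ K : ℝ, ∀ n,
      birkhoff f (fun y => a * g y - (a * (∫ x, g x ∂μ) + 1 / ((k : ℝ) + 1))) n x ≤ K := by
    intro k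
    apply ae_bdd_of_neg herg ((hgm.const_mul a).sub_const _)
      ((hg.const_mul a).sub (integrable_const _))
    rw [MeasureTheory.integral_sub (hg.const_mul a) (integrable_const _), MeasureTheory.integral_const_mul]
    simp
    positivity
  filter_upwards [ae_all_iff.2 h] with x hx ε hε
  obtain ⟨k, hk⟩ := exists_nat_one_div_lt (half_pos hε)
  obtain ⟨K, hK⟩ := hx k
  have ht : Tendsto (fun n : ℕ => K / n) atTop (𝓝 0) := tendsto_const_div_atTop_nhds_zero_nat K
  filter_upwards [ht.eventually (gt_mem_nhds (half_pos hε)), eventually_gt_atTop 0] with n hn hn0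
  have hn0' : (0 : ℝ) < n := by exact_mod_cast hn0
  have := hK n
  rw [birkhoff_affine] at this
  have h2 : a * (birkhoff f g n x / n) ≤ K / n + (a * (∫ x, g x ∂μ) + 1 / ((k : ℝ) + 1)) := by
    rw [← mul_div_assoc, div_add' _ _ _ hn0'.ne', div_le_div_iff_of_pos_right hn0']
    linarith
  linarith

lemma ae_birkhoff_tendsto {f : M → M} {μ : Measure M} [IsProbabilityMeasure μ]
    (herg : Ergodic f μ) {g : M → ℝ} (hgm : Measurable g) (hg : Integrable g μ) :
    ∀ᵐ x ∂μ, Tendsto (fun n : ℕ => birkhoff f g n x / n) atTop (𝓝 (∫ x, g x ∂μ)) := by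
  filter_upwards [ae_birkhoff_upper herg hgm hg 1, ae_birkhoff_upper herg hgm hg (-1)]
    with x h1 h2
  rw [tendsto_order]
  constructor
  · intro a ha
    filter_upwards [h2 ((∫ x, g x ∂μ) - a) (by linarith)] with n hn
    linarith
  · intro a ha
    filter_upwards [h1 (a - (∫ x, g x ∂μ)) (by linarith)] with n hn
    linarith

end aux

section flow

variable {M : Type*} {f : M → M} {r : M → ℝ} {r₀ : ℝ}

lemma birkhoff_strictMono (hr₀ : 0 < r₀) (hr : ∀ x, r₀ ≤ r x) (x : M) :
    StrictMono (fun n => birkhoff f r n x) := by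
  apply strictMono_nat_of_lt_succ
  intro n
  rw [birkhoff_succ_right]
  linarith [hr (f^[n] x)]

lemma birkhoff_lower (hr : ∀ x, r₀ ≤ r x) (x : M) (n : ℕ) :
    n * r₀ ≤ birkhoff f r n x := by
  induction n with
  | zero => simp [birkhoff_zero']
  | succ n ih =>
    rw [birkhoff_succ_right]
    push_cast
    linarith [hr (f^[n] x)]

lemma lap_bdd (hr₀ : 0 < r₀) (hr : ∀ x, r₀ ≤ r x) (x : M) (u : ℝ) :
    BddAbove {n : ℕ | birkhoff f r n x ≤ u} := by
  obtain ⟨k, hk⟩ := exists_nat_gt (u / r₀)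
  refine ⟨k, fun n hn => ?_⟩
  have h1 : (n : ℝ) * r₀ ≤ u := (birkhoff_lower hr x n).trans hn
  have h2 : (n : ℝ) ≤ u / r₀ := by rwa [le_div_iff₀ hr₀]
  exact_mod_cast (h2.trans_lt hk).le

lemma le_lap (hr₀ : 0 < r₀) (hr : ∀ x, r₀ ≤ r x) (x : M) (u : ℝ) (n : ℕ)
    (h : birkhoff f r n x ≤ 0 + u) : n ≤ lap f r x 0 u :=
  le_csSup (lap_bdd hr₀ hr x _) h

lemma lap_le_self (hr₀ : 0 < r₀) (hr : ∀ x, r₀ ≤ r x) (x : M) (u : ℝ) (hu : 0 ≤ u) :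
    birkhoff f r (lap f r x 0 u) x ≤ u := by
  have := Nat.sSup_mem (s := {n : ℕ | birkhoff f r n x ≤ 0 + u})
    ⟨0, by simpa [birkhoff_zero'] using hu⟩ (lap_bdd hr₀ hr x _)
  simpa [lap] using this

lemma lt_lap_succ (hr₀ : 0 < r₀) (hr : ∀ x, r₀ ≤ r x) (x : M) (u : ℝ) :
    u < birkhoff f r (lap f r x 0 u + 1) x := by
  by_contra! h
  have := le_lap hr₀ hr x u _ (by simpa using h)
  omega

lemma lap_eq (hr₀ : 0 < r₀) (hr : ∀ x, r₀ ≤ r x) (x : M) (u : ℝ) (n : ℕ)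
    (h1 : birkhoff f r n x ≤ u) (h2 : u < birkhoff f r (n + 1) x) : lap f r x 0 u = n := by
  have hs := birkhoff_strictMono (f := f) hr₀ hr x
  apply le_antisymm
  · have h0 : 0 ≤ u := by
      have := hs.monotone (Nat.zero_le n)
      simp only [birkhoff_zero'] at this
      linarith
    have := (lap_le_self (f := f) hr₀ hr x u h0).trans_lt h2
    exact Nat.lt_succ_iff.1 (hs.lt_iff_lt.1 this)
  · exact le_lap hr₀ hr x u n (by simpa using h1)

lemma lap_mono (hr₀ : 0 < r₀) (hr : ∀ x, r₀ ≤ r x) (x : M) :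
    Monotone (fun u => lap f r x 0 u) := by
  intro u v huv
  by_cases hu : 0 ≤ u
  · exact le_lap hr₀ hr x v _ (by simpa using (lap_le_self hr₀ hr x u hu).trans huv)
  · have : lap f r x 0 u = 0 := by
      have : {n : ℕ | birkhoff f r n x ≤ 0 + u} = ∅ := by
        ext n
        simp only [Set.mem_ofPred_eq, Set.mem_empty_iff_false, iff_false]
        have := birkhoff_lower (f := f) hr x n
        have : 0 ≤ (n : ℝ) * r₀ := by positivity
        linarith
      rw [lap, this]; simp
    simp [this]

lemma lap_tendsto (hr₀ : 0 < r₀) (hr : ∀ x, r₀ ≤ r x) (x : M) :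
    Tendsto (fun u => lap f r x 0 u) atTop atTop := by
  apply tendsto_atTop.2
  intro k
  filter_upwards [eventually_ge_atTop (birkhoff f r k x)] with u hu
  exact le_lap hr₀ hr x u k (by simpa using hu)

lemma suspFlow_shift (x : M) (s t : ℝ) :
    suspFlow f r t (x, s) = suspFlow f r (s + t) (x, 0) := by
  simp [suspFlow, lap]

variable [MeasurableSpace M]

lemma flow_measurable (hr₀ : 0 < r₀) (hr : ∀ x, r₀ ≤ r x) (x : M) :
    Measurable (fun u : ℝ => suspFlow f r u (x, 0)) := by
  have hN : Measurable (fun u => lap f r x 0 u) := (lap_mono hr₀ hr x).measurable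
  have h1 : Measurable (fun n : ℕ => f^[n] x) := measurable_from_nat
  have h2 : Measurable (fun n : ℕ => birkhoff f r n x) := measurable_from_nat
  simp only [suspFlow]
  exact (h1.comp hN).prodMk ((measurable_id.const_add 0).sub (h2.comp hN))

lemma flow_intervalIntegrable (hr₀ : 0 < r₀) (hr : ∀ x, r₀ ≤ r x) {ψ : M × ℝ → ℝ}
    (hψm : Measurable ψ) {C : ℝ} (hψb : ∀ z, |ψ z| ≤ C) (x : M) (a b : ℝ) :
    IntervalIntegrable (fun u => ψ (suspFlow f r u (x, 0))) volume a b := by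
  refine (intervalIntegrable_const (c := C)).mono_fun
    (hψm.comp (flow_measurable hr₀ hr x)).aestronglyMeasurable ?_
  refine Eventually.of_forall fun u => ?_
  exact (hψb _).trans (le_abs_self C)

lemma integral_birkhoff (hr₀ : 0 < r₀) (hr : ∀ x, r₀ ≤ r x) {ψ : M × ℝ → ℝ}
    (hψm : Measurable ψ) {C : ℝ} (hψb : ∀ z, |ψ z| ≤ C)
    {φ : M → ℝ} (hφ : ∀ x, φ x = ∫ t in (0 : ℝ)..(r x), ψ (x, t)) (x : M) (n : ℕ) :
    ∫ u in (0 : ℝ)..(birkhoff f r n x), ψ (suspFlow f r u (x, 0)) = birkhoff f φ n x := by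
  induction n with
  | zero => simp [birkhoff_zero']
  | succ n ih =>
    rw [← integral_add_adjacent_intervals (b := birkhoff f r n x)
      (flow_intervalIntegrable hr₀ hr hψm hψb x _ _)
      (flow_intervalIntegrable hr₀ hr hψm hψb x _ _), ih, birkhoff_succ_right f φ, hφ]
    congr 1
    have e : ∫ u in (birkhoff f r n x)..(birkhoff f r (n + 1) x), ψ (suspFlow f r u (x, 0))
        = ∫ u in (birkhoff f r n x)..(birkhoff f r (n + 1) x),
            ψ (f^[n] x, u - birkhoff f r n x) := by
      have hle : birkhoff f r n x ≤ birkhoff f r (n + 1) x :=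
        (birkhoff_strictMono (f := f) hr₀ hr x).monotone (Nat.le_succ n)
      rw [integral_of_le hle, integral_of_le hle, ← integral_Ico_eq_integral_Ioc,
        ← integral_Ico_eq_integral_Ioc]
      refine setIntegral_congr_fun measurableSet_Ico fun u hu => ?_
      have := lap_eq hr₀ hr x u n hu.1 hu.2
      simp [suspFlow, this]
    rw [e, integral_comp_sub_right (fun u => ψ (f^[n] x, u)), birkhoff_succ_right]
    simp

lemma phi_measurable (hrm : Measurable r) (hr₀ : 0 < r₀) (hr : ∀ x, r₀ ≤ r x) {ψ : M × ℝ → ℝ}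
    (hψm : Measurable ψ)
    {φ : M → ℝ} (hφ : ∀ x, φ x = ∫ t in (0 : ℝ)..(r x), ψ (x, t)) : Measurable φ := by
  have hS : MeasurableSet {z : M × ℝ | 0 < z.2 ∧ z.2 ≤ r z.1} :=
    (measurableSet_lt measurable_const measurable_snd).inter
      (measurableSet_le measurable_snd (hrm.comp measurable_fst))
  have h := ((hψm.indicator hS).stronglyMeasurable.integral_prod_right' (ν := volume)).measurable
  convert h using 1
  ext x
  rw [hφ, integral_of_le (by linarith [hr x]), ← MeasureTheory.integral_indicator measurableSet_Ioc]
  rfl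

lemma phi_bound (hr₀ : 0 < r₀) (hr : ∀ x, r₀ ≤ r x) {ψ : M × ℝ → ℝ}
    {C : ℝ} (hψb : ∀ z, |ψ z| ≤ C)
    {φ : M → ℝ} (hφ : ∀ x, φ x = ∫ t in (0 : ℝ)..(r x), ψ (x, t)) (x : M) :
    |φ x| ≤ C * r x := by
  have := norm_integral_le_of_norm_le_const (a := 0) (b := r x) (C := C)
    (f := fun t => ψ (x, t)) (fun t _ => hψb _)
  rw [hφ]
  simpa [abs_of_nonneg (show 0 ≤ r x by linarith [hr x])] using this

lemma flow_tendsto (hr₀ : 0 < r₀) (hr : ∀ x, r₀ ≤ r x) {ψ : M × ℝ → ℝ}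
    (hψm : Measurable ψ) {C : ℝ} (hψb : ∀ z, |ψ z| ≤ C)
    {φ : M → ℝ} (hφ : ∀ x, φ x = ∫ t in (0 : ℝ)..(r x), ψ (x, t)) (x : M) {R P : ℝ}
    (hR : 0 < R) (h1 : Tendsto (fun n : ℕ => birkhoff f r n x / n) atTop (𝓝 R))
    (h2 : Tendsto (fun n : ℕ => birkhoff f φ n x / n) atTop (𝓝 P)) (s : ℝ) (hs : 0 ≤ s) :
    Tendsto (fun T : ℝ => (1 / T) * ∫ t in (0 : ℝ)..T, ψ (suspFlow f r t (x, s)))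
        atTop (𝓝 (P / R)) := by
  set N : ℝ → ℕ := fun T => lap f r x 0 (s + T) with hN
  have hNt : Tendsto N atTop atTop :=
    (lap_tendsto hr₀ hr x).comp (tendsto_atTop_add_const_left _ s tendsto_id)
  have hinv : Tendsto (fun n : ℕ => s / (n : ℝ)) atTop (𝓝 0) :=
    tendsto_const_div_atTop_nhds_zero_nat s
  have h1' : Tendsto (fun n : ℕ => birkhoff f r (n + 1) x / n) atTop (𝓝 R) := by
    have a := (tendsto_add_atTop_iff_nat 1).2 h1
    have b : Tendsto (fun n : ℕ => 1 + 1 / (n : ℝ)) atTop (𝓝 1) := by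
      simpa using tendsto_const_nhds.add (tendsto_const_div_atTop_nhds_zero_nat (1 : ℝ))
    have c := a.mul b
    rw [mul_one] at c
    refine c.congr' ?_
    filter_upwards [eventually_gt_atTop 0] with n hn
    have : (n : ℝ) ≠ 0 := by positivity
    push_cast
    field_simp
  have hNpos : ∀ᶠ T in atTop, 0 < N T := hNt.eventually (eventually_gt_atTop 0)
  have hT : Tendsto (fun T : ℝ => T / N T) atTop (𝓝 R) := by
    have lo := (h1.sub hinv).comp hNt
    have hi := (h1'.sub hinv).comp hNt
    rw [sub_zero] at lo hi
    refine tendsto_of_tendsto_of_tendsto_of_le_of_le' lo hi ?_ ?_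
    · filter_upwards [hNpos, eventually_ge_atTop 0] with T hT hT0
      have hp : (0 : ℝ) < N T := by exact_mod_cast hT
      have := lap_le_self (f := f) hr₀ hr x (s + T) (by linarith)
      simp only [Function.comp]
      rw [← sub_div, div_le_div_iff_of_pos_right hp]
      simp only [hN]; linarith
    · filter_upwards [hNpos, eventually_ge_atTop 0] with T hT hT0
      have hp : (0 : ℝ) < N T := by exact_mod_cast hT
      have := lt_lap_succ (f := f) hr₀ hr x (s + T)
      simp only [Function.comp]
      rw [← sub_div, div_le_div_iff_of_pos_right hp]
      simp only [hN]; linarith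
  have hC : 0 ≤ C := (abs_nonneg _).trans (hψb (x, 0))
  have hF : Tendsto (fun T : ℝ => (∫ t in (0 : ℝ)..T, ψ (suspFlow f r t (x, s))) / N T)
      atTop (𝓝 P) := by
    have hd : Tendsto (fun T : ℝ => (∫ t in (0 : ℝ)..T, ψ (suspFlow f r t (x, s))) / N T
        - birkhoff f φ (N T) x / N T) atTop (𝓝 0) := by
      have hb : Tendsto (fun n : ℕ => C * (birkhoff f r (n + 1) x / n - birkhoff f r n x / n
          + s / n)) atTop (𝓝 0) := by
        have := ((h1'.sub h1).add hinv).const_mul C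
        simpa using this
      refine squeeze_zero_norm' ?_ (hb.comp hNt)
      filter_upwards [hNpos, eventually_ge_atTop 0] with T hT hT0
      have hp : (0 : ℝ) < N T := by exact_mod_cast hT
      have hlo := lap_le_self (f := f) hr₀ hr x (s + T) (by linarith)
      have hhi := lt_lap_succ (f := f) hr₀ hr x (s + T)
      have hI := flow_intervalIntegrable (f := f) hr₀ hr hψm hψb x
      have e1 : ∫ t in (0 : ℝ)..T, ψ (suspFlow f r t (x, s))
          = ∫ u in s..(s + T), ψ (suspFlow f r u (x, 0)) := by
        simp only [suspFlow_shift x s]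
        rw [integral_comp_add_left (fun u => ψ (suspFlow f r u (x, 0)))]
        simp
      have e2 := integral_add_adjacent_intervals (hI 0 s) (hI s (s + T))
      have e3 := integral_add_adjacent_intervals (hI 0 (birkhoff f r (N T) x))
        (hI (birkhoff f r (N T) x) (s + T))
      rw [integral_birkhoff hr₀ hr hψm hψb hφ] at e3
      have b1 := norm_integral_le_of_norm_le_const (a := 0) (b := s) (C := C)
        (f := fun u => ψ (suspFlow f r u (x, 0))) (fun t _ => hψb _)
      have b2 := norm_integral_le_of_norm_le_const (a := birkhoff f r (N T) x) (b := s + T)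
        (C := C) (f := fun u => ψ (suspFlow f r u (x, 0))) (fun t _ => hψb _)
      have hlo' : birkhoff f r (N T) x ≤ s + T := hlo
      have hhi' : s + T < birkhoff f r (N T + 1) x := hhi
      rw [Real.norm_eq_abs, sub_zero, abs_of_nonneg hs, abs_le] at b1
      rw [Real.norm_eq_abs, abs_of_nonneg (sub_nonneg.2 hlo'), abs_le] at b2
      have b3 : C * (s + T - birkhoff f r (N T) x)
          ≤ C * (birkhoff f r (N T + 1) x - birkhoff f r (N T) x) :=
        mul_le_mul_of_nonneg_left (by linarith) hC
      simp only [Function.comp]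
      rw [Real.norm_eq_abs, ← sub_div, ← sub_div, ← add_div, abs_div, abs_of_pos hp,
        ← mul_div_assoc, div_le_div_iff_of_pos_right hp, e1, mul_add, abs_le]
      constructor <;> linarith
    have := hd.add (h2.comp hNt)
    simpa using this
  have := hF.div hT hR.ne'
  refine this.congr' ?_
  filter_upwards [hNpos, eventually_gt_atTop 0] with T hT hT0
  have hp : (N T : ℝ) ≠ 0 := by
    have : (0 : ℝ) < N T := by exact_mod_cast hT
    exact this.ne'
  simp only [Pi.div_apply]
  field_simp

end flow

/-- Birkhoff-type theorem for suspension semiflows: if `μ` is ergodic for `f`,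
`r ≥ r₀ > 0` is `μ`-integrable, `ψ` is bounded measurable and
`φ(x) = ∫_0^{r x} ψ(x,t) dt`, then for `μ`-a.e. `x` and all `0 ≤ s < r x`,
`(1/T) ∫_0^T ψ(X^t(x,s)) dt → (∫ φ dμ) / (∫ r dμ)` as `T → ∞`. -/
theorem suspFlow_time_average {M : Type*} [MeasurableSpace M]
    (f : M → M) (hf : Measurable f) (μ : Measure M) [IsProbabilityMeasure μ]
    (herg : Ergodic f μ)
    (r : M → ℝ) (hrm : Measurable r) (r₀ : ℝ) (hr₀ : 0 < r₀) (hr : ∀ x, r₀ ≤ r x)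
    (hri : Integrable r μ)
    (ψ : M × ℝ → ℝ) (hψm : Measurable ψ) (C : ℝ) (hψb : ∀ z, |ψ z| ≤ C)
    (φ : M → ℝ) (hφ : ∀ x, φ x = ∫ t in (0 : ℝ)..(r x), ψ (x, t)) :
    ∀ᵐ x ∂μ, ∀ s : ℝ, 0 ≤ s → s < r x →
      Tendsto (fun T : ℝ => (1 / T) * ∫ t in (0 : ℝ)..T, ψ (suspFlow f r t (x, s)))
        atTop (𝓝 ((∫ x, φ x ∂μ) / ∫ x, r x ∂μ)) := by
  have hφm := phi_measurable hrm hr₀ hr hψm hφ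
  have hφi : Integrable φ μ := by
    refine (hri.const_mul C).mono' hφm.aestronglyMeasurable ?_
    exact Eventually.of_forall fun x => phi_bound hr₀ hr hψb hφ x
  have hR : 0 < ∫ x, r x ∂μ := by
    have := integral_mono (integrable_const r₀) hri hr
    simp at this
    linarith
  filter_upwards [ae_birkhoff_tendsto herg hrm hri, ae_birkhoff_tendsto herg hφm hφi]
    with x h1 h2 s hs _
  exact flow_tendsto hr₀ hr hψm hψb hφ x hR h1 h2 s hs
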